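/- Let k : ℝ and define f₁ : ℝ → ℂ by f₁ R = -Complex.I * Complex.log (Complex.cosh (Complex.I * k * R)) + Complex.I * Real.log R. Then for every R > 0 with Real.cos (k*R) ≠ 0, deriv (deriv f₁) R + Complex.I * (deriv f₁ R)^2 + (2/R) * deriv f₁ R - Complex.I * k^2 = 0. -/

import Mathlib

lemma rp_cosh (k x : ℝ) :
    Complex.cosh (Complex.I * k * x) = ((Real.cos (k * x) : ℝ) : ℂ) := by
  rw [show Complex.I * (k:ℂ) * x = ((k * x : ℝ) : ℂ) * Complex.I by push_cast; ring,
    Complex.cosh_mul_I, Complex.ofReal_cos]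

lemma rp_log (c : ℝ) :
    Complex.log (c : ℂ) = (Real.log c : ℂ) + (Complex.arg c : ℂ) * Complex.I := by
  rw [Complex.log, Complex.norm_real, Real.norm_eq_abs, Real.log_abs]

lemma rp_arg (k x : ℝ) (hc : Real.cos (k * x) ≠ 0) :
    ∀ᶠ y in nhds x, Complex.arg (Real.cos (k * y) : ℂ) = Complex.arg (Real.cos (k * x) : ℂ) := by
  have hcont : ContinuousAt (fun y : ℝ => Real.cos (k * y)) x := by fun_prop
  rcases lt_or_gt_of_ne hc with h | h
  · filter_upwards [hcont.eventually (gt_mem_nhds h)] with y hy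
    rw [Complex.arg_ofReal_of_neg hy, Complex.arg_ofReal_of_neg h]
  · filter_upwards [hcont.eventually (lt_mem_nhds h)] with y hy
    rw [Complex.arg_ofReal_of_nonneg (le_of_lt hy), Complex.arg_ofReal_of_nonneg (le_of_lt h)]

lemma rp_cos_deriv (k x : ℝ) :
    HasDerivAt (fun y : ℝ => Real.cos (k * y)) (-Real.sin (k * x) * k) x := by
  simpa using ((hasDerivAt_id x).const_mul k).cos

lemma rp_sin_deriv (k x : ℝ) :
    HasDerivAt (fun y : ℝ => Real.sin (k * y)) (Real.cos (k * x) * k) x := by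
  simpa using ((hasDerivAt_id x).const_mul k).sin

lemma rp_deriv (k x : ℝ) (hx : 0 < x) (hc : Real.cos (k * x) ≠ 0) :
    HasDerivAt (fun R : ℝ =>
      -Complex.I * Complex.log (Complex.cosh (Complex.I * k * R))
        + Complex.I * (Real.log R : ℂ))
      (Complex.I * ((k * (Real.sin (k * x) / Real.cos (k * x)) + x⁻¹ : ℝ) : ℂ)) x := by
  have h1 := ((rp_cos_deriv k x).log hc).ofReal_comp
  have h2 := (Real.hasDerivAt_log hx.ne').ofReal_comp
  have h3 := ((h1.add_const ((Complex.arg (Real.cos (k * x) : ℂ) : ℂ) * Complex.I)).const_mul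
    (-Complex.I)).add (h2.const_mul Complex.I)
  refine (h3.congr_of_eventuallyEq ?_).congr_deriv ?_
  · filter_upwards [rp_arg k x hc] with y hy
    simp only [Pi.add_apply]
    rw [rp_cosh, rp_log, hy]
  · push_cast
    ring

theorem radial_phase_equation_cosh (k : ℝ) (f₁ : ℝ → ℂ)
    (hf : f₁ = fun R : ℝ =>
      -Complex.I * Complex.log (Complex.cosh (Complex.I * k * R))
        + Complex.I * (Real.log R : ℂ))
    (R : ℝ) (hR : 0 < R) (hcos : Real.cos (k*R) ≠ 0) :
    deriv (deriv f₁) R + Complex.I * (deriv f₁ R)^2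
      + (2/(R:ℂ)) * deriv f₁ R - Complex.I * (k:ℂ)^2 = 0 := by
  have hd : ∀ x : ℝ, 0 < x → Real.cos (k * x) ≠ 0 → deriv f₁ x =
      Complex.I * ((k * (Real.sin (k * x) / Real.cos (k * x)) + x⁻¹ : ℝ) : ℂ) := by
    intro x hx hc
    rw [hf]
    exact (rp_deriv k x hx hc).deriv
  have hcont : ContinuousAt (fun y : ℝ => Real.cos (k * y)) R := by fun_prop
  have hev : deriv f₁ =ᶠ[nhds R] fun x =>
      Complex.I * ((k * (Real.sin (k * x) / Real.cos (k * x)) + x⁻¹ : ℝ) : ℂ) := by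
    filter_upwards [hcont.eventually_ne hcos, lt_mem_nhds hR] with y hy hy0
    exact hd y hy0 hy
  have h2 := (((((rp_sin_deriv k R).div (rp_cos_deriv k R) hcos).const_mul k).add
    (hasDerivAt_inv hR.ne')).ofReal_comp).const_mul Complex.I
  have h3 := (h2.congr_of_eventuallyEq hev).deriv
  rw [h3, hd R hR hcos]
  have hs := Real.sin_sq_add_cos_sq (k * R)
  generalize Real.sin (k * R) = s at *
  generalize Real.cos (k * R) = c at *
  have hc' : (c : ℂ) ≠ 0 := by exact_mod_cast hcos
  have hR' : (R : ℂ) ≠ 0 := by exact_mod_cast hR.ne'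
  have hs' : (s : ℂ)^2 + (c : ℂ)^2 = 1 := by exact_mod_cast hs
  have hI := Complex.I_sq
  have hI3 : Complex.I ^ 3 = -Complex.I := by rw [pow_succ, hI]; ring
  push_cast
  rw [mul_pow, hI]
  field_simp
  ring
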